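/- There exist constants C>0 and h_0>0, depending only on k, α, β, γ, b-a and the quasi-uniformity constant c, such that whenever h ≤ h_0, u is (k+2)-times continuously differentiable with u(a)=u(b)=0, f := -αu''+βu'+γu, and u_h is a Petrov–Galerkin solution, then |(u-u_h)''(g_{in})| ≤ C h^{k} ‖u‖_{k+2,∞} at each of the k-1 Gauss points g_{in} of every element τ_i (second derivatives of u_h taken elementwise). -/

import Mathlib

open Set Finset intervalIntegral

/-- The Legendre polynomial of degree `n` (Rodrigues formula), as a real function. -/
noncomputable def legendre (n : ℕ) : ℝ → ℝ :=
  fun s => (1 / ((2 : ℝ) ^ n * n.factorial)) * iteratedDeriv n (fun t : ℝ => (t ^ 2 - 1) ^ n) s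

/-- The affine map sending `[-1,1]` onto `[p,q]`. -/
noncomputable def affMap (p q s : ℝ) : ℝ := (p + q) / 2 + s * (q - p) / 2

/-- `x 0 = a < x 1 < ... < x N = b` is a partition of `[a,b]`. -/
def IsMesh (a b : ℝ) (N : ℕ) (x : ℕ → ℝ) : Prop :=
  1 ≤ N ∧ x 0 = a ∧ x N = b ∧ ∀ i < N, x i < x (i + 1)

/-- `h` is the maximal element length `h = max_i (x i - x (i-1))`. -/
def IsMeshSize (N : ℕ) (x : ℕ → ℝ) (h : ℝ) : Prop :=
  (∀ i ∈ Finset.Icc 1 N, x i - x (i - 1) ≤ h) ∧ ∃ i ∈ Finset.Icc 1 N, x i - x (i - 1) = h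

/-- Quasi-uniformity with constant `c`: `h ≤ c · h_i` for all elements. -/
def IsQuasiUniform (N : ℕ) (x : ℕ → ℝ) (h c : ℝ) : Prop :=
  ∀ i ∈ Finset.Icc 1 N, h ≤ c * (x i - x (i - 1))

/-- `P i` are the element polynomials (degree ≤ k) of a member of `V_h^0`:
a C¹ piecewise polynomial vanishing at both ends of `[a,b]`. -/
def IsVh0 (k N : ℕ) (x : ℕ → ℝ) (P : ℕ → Polynomial ℝ) : Prop :=
  (∀ i ∈ Finset.Icc 1 N, (P i).natDegree ≤ k) ∧
  (∀ i ∈ Finset.Icc 1 (N - 1), (P i).eval (x i) = (P (i + 1)).eval (x i)) ∧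
  (∀ i ∈ Finset.Icc 1 (N - 1),
      (Polynomial.derivative (P i)).eval (x i) = (Polynomial.derivative (P (i + 1))).eval (x i)) ∧
  (P 1).eval (x 0) = 0 ∧ (P N).eval (x N) = 0

/-- `P i` are the element polynomials of a Petrov–Galerkin solution `u_h ∈ V_h^0`:
`∑_i ∫_{τ_i} (-α u_h'' + β u_h' + γ u_h) v_h = ∫_a^b f v_h` for all `v_h ∈ W_h`. -/
def IsPGSol (k N : ℕ) (x : ℕ → ℝ) (α β γ : ℝ) (f : ℝ → ℝ) (P : ℕ → Polynomial ℝ) : Prop :=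
  IsVh0 k N x P ∧
  ∀ Q : ℕ → Polynomial ℝ, (∀ i ∈ Finset.Icc 1 N, (Q i).natDegree ≤ k - 2) →
    (∑ i ∈ Finset.Icc 1 N, ∫ t in (x (i - 1))..(x i),
        (-α * ((Polynomial.derivative (Polynomial.derivative (P i))).eval t)
            + β * ((Polynomial.derivative (P i)).eval t) + γ * (P i).eval t) * (Q i).eval t)
      = ∑ i ∈ Finset.Icc 1 N, ∫ t in (x (i - 1))..(x i), f t * (Q i).eval t

/-- `P i` are the element polynomials of a Gauss collocation solution `ū_h ∈ V_h^0`: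
`(-α ū_h'' + β ū_h' + γ ū_h)(g) = f(g)` at every Gauss point `g` of every element. -/
def IsGaussSol (k N : ℕ) (x : ℕ → ℝ) (α β γ : ℝ) (f : ℝ → ℝ) (P : ℕ → Polynomial ℝ) : Prop :=
  IsVh0 k N x P ∧
  ∀ i ∈ Finset.Icc 1 N, ∀ s ∈ Set.Ioo (-1 : ℝ) 1, legendre (k - 1) s = 0 →
    -α * ((Polynomial.derivative (Polynomial.derivative (P i))).eval (affMap (x (i - 1)) (x i) s))
        + β * ((Polynomial.derivative (P i)).eval (affMap (x (i - 1)) (x i) s))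
        + γ * (P i).eval (affMap (x (i - 1)) (x i) s)
      = f (affMap (x (i - 1)) (x i) s)

/-- `p` is the elementwise truncated Jacobi projection of `u` on the element `[xl, xr]`:
the polynomial of degree ≤ k matching `u` and `u'` at both endpoints with
`(u - p)'' ⊥ P_{k-2}` in `L²(xl, xr)`. -/
def IsElemProj (k : ℕ) (u : ℝ → ℝ) (xl xr : ℝ) (p : Polynomial ℝ) : Prop :=
  p.natDegree ≤ k ∧ p.eval xl = u xl ∧ p.eval xr = u xr ∧
  (Polynomial.derivative p).eval xl = deriv u xl ∧
  (Polynomial.derivative p).eval xr = deriv u xr ∧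
  ∀ q : Polynomial ℝ, q.natDegree ≤ k - 2 →
    (∫ t in xl..xr,
        (iteratedDeriv 2 u t - (Polynomial.derivative (Polynomial.derivative p)).eval t)
          * q.eval t) = 0

/-- On polynomials of degree at most `m`, the sup norm over `[-1,1]` is controlled by the `L²`
norm. -/
theorem exists_sq_eval_le_integral_sq (m : ℕ) :
    ∃ C > 0, ∀ q : Polynomial ℝ, q.natDegree ≤ m → ∀ s ∈ Set.Icc (-1 : ℝ) 1,
      (q.eval s) ^ 2 ≤ C * ∫ t in (-1 : ℝ)..1, (q.eval t) ^ 2 := by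
  set F : (Fin (m + 1) → ℝ) → ℝ :=
    fun v => ∫ t in (-1 : ℝ)..1, (∑ j, v j * t ^ (j : ℕ)) ^ 2 with hF
  have hFcont : Continuous F := by
    apply intervalIntegral.continuous_parametric_intervalIntegral_of_continuous'
    simp only [Function.uncurry_def]
    fun_prop
  have hFpos : ∀ v : Fin (m + 1) → ℝ, v ≠ 0 → 0 < F v := by
    intro v hv
    apply intervalIntegral.integral_pos (by norm_num) (by fun_prop) (fun t _ => sq_nonneg _)
    by_contra! hzero
    apply hv
    set q : Polynomial ℝ :=
      ∑ j : Fin (m + 1), Polynomial.C (v j) * Polynomial.X ^ (j : ℕ) with hq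
    have hq0 : q = 0 := by
      apply Polynomial.eq_zero_of_infinite_isRoot
      refine (Set.Icc_infinite (show (-1 : ℝ) < 1 by norm_num)).mono fun t ht => ?_
      have h0 := pow_eq_zero_iff (two_ne_zero) |>.1 (le_antisymm (hzero t ht) (sq_nonneg _))
      simpa [Polynomial.IsRoot, hq, Polynomial.eval_finsetSum] using h0
    ext i
    have hi := congrArg (fun r => Polynomial.coeff r (i : ℕ)) hq0
    simpa [hq, Polynomial.finsetSum_coeff, Polynomial.coeff_X_pow, Fin.val_inj] using hi
  have hne : (Metric.sphere (0 : Fin (m + 1) → ℝ) 1).Nonempty :=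
    NormedSpace.sphere_nonempty.2 zero_le_one
  obtain ⟨v₀, hv₀, hmin⟩ := (isCompact_sphere (0 : Fin (m + 1) → ℝ) 1).exists_isMinOn hne
    hFcont.continuousOn
  have hδ : 0 < F v₀ := hFpos v₀ (by
    rintro rfl
    simp at hv₀)
  refine ⟨((m : ℝ) + 1) ^ 2 / F v₀, by positivity, fun q hq s hs => ?_⟩
  set v : Fin (m + 1) → ℝ := fun j => q.coeff j with hv
  have heval : ∀ t, q.eval t = ∑ j, v j * t ^ (j : ℕ) := fun t => by
    rw [Polynomial.eval_eq_sum_range' (Nat.lt_succ_of_le hq), Finset.sum_range]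
  have hint : ∫ t in (-1 : ℝ)..1, (q.eval t) ^ 2 = F v := by simp only [heval, hF]
  have hlow : F v₀ * ‖v‖ ^ 2 ≤ F v := by
    by_cases hv0 : v = 0
    · simp [hv0, hF]
    have hnv : ‖v‖ ≠ 0 := norm_ne_zero_iff.2 hv0
    have h1 : F v₀ ≤ F (‖v‖⁻¹ • v) := hmin (by simp [norm_smul, hnv])
    have h2 : F (‖v‖⁻¹ • v) = (‖v‖⁻¹) ^ 2 * F v := by
      simp only [hF, ← intervalIntegral.integral_const_mul, ← mul_pow, Finset.mul_sum,
        Pi.smul_apply, smul_eq_mul, mul_assoc]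
    rw [h2, inv_pow, ← div_eq_inv_mul, le_div_iff₀ (by positivity)] at h1
    exact h1
  have hup : |q.eval s| ≤ ((m : ℝ) + 1) * ‖v‖ := by
    rw [heval]
    calc |∑ j, v j * s ^ (j : ℕ)| ≤ ∑ j : Fin (m + 1), |v j * s ^ (j : ℕ)| :=
          Finset.abs_sum_le_sum_abs _ _
      _ ≤ ∑ _j : Fin (m + 1), ‖v‖ := by
          refine Finset.sum_le_sum fun j _ => ?_
          rw [abs_mul, abs_pow]
          calc |v j| * |s| ^ (j : ℕ) ≤ ‖v‖ * 1 := by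
                gcongr
                · exact norm_le_pi_norm v j
                · exact pow_le_one₀ (abs_nonneg _) (abs_le.2 hs)
            _ = ‖v‖ := mul_one _
      _ = ((m : ℝ) + 1) * ‖v‖ := by simp
  rw [hint, ← sq_abs]
  calc |q.eval s| ^ 2 ≤ (((m : ℝ) + 1) * ‖v‖) ^ 2 := by gcongr
    _ = ((m : ℝ) + 1) ^ 2 / F v₀ * (F v₀ * ‖v‖ ^ 2) := by field_simp
    _ ≤ _ := by gcongr

theorem exists_abs_eval_le_of_integral_add_mul_eq_zero (m : ℕ) :
    ∃ C > 0, ∀ (q : Polynomial ℝ) (g : ℝ → ℝ) (G : ℝ), q.natDegree ≤ m → Continuous g →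
      (∀ t ∈ Set.Icc (-1 : ℝ) 1, |g t| ≤ G) →
      (∀ v : Polynomial ℝ, v.natDegree ≤ m →
        ∫ t in (-1 : ℝ)..1, (q.eval t + g t) * v.eval t = 0) →
      ∀ s ∈ Set.Icc (-1 : ℝ) 1, |q.eval s| ≤ C * G := by
  obtain ⟨C, hC, hle⟩ := exists_sq_eval_le_integral_sq m
  refine ⟨2 * C, by positivity, fun q g G hq hg hG horth s hs => ?_⟩
  obtain ⟨s₀, hs₀, hmax⟩ := (isCompact_Icc (a := (-1 : ℝ)) (b := 1)).exists_isMaxOn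
    ⟨s, hs⟩ (f := fun t => |q.eval t|) (by fun_prop)
  refine (hmax hs).trans ?_
  change |q.eval s₀| ≤ _
  have hG0 : 0 ≤ G := (abs_nonneg _).trans (hG s hs)
  set S := |q.eval s₀| with hS
  have hS0 : 0 ≤ S := abs_nonneg _
  have hsq : ∫ t in (-1 : ℝ)..1, (q.eval t) ^ 2 = -∫ t in (-1 : ℝ)..1, g t * q.eval t := by
    rw [eq_neg_iff_add_eq_zero, ← intervalIntegral.integral_add
      (Continuous.intervalIntegrable (by fun_prop) _ _)
      (Continuous.intervalIntegrable (by fun_prop) _ _), ← horth q hq]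
    congr 1
    ext t
    ring
  have hb : |∫ t in (-1 : ℝ)..1, g t * q.eval t| ≤ G * S * 2 := by
    have := intervalIntegral.norm_integral_le_of_norm_le_const (a := (-1 : ℝ)) (b := 1)
      (C := G * S) (f := fun t => g t * q.eval t) (fun t ht => by
        rw [Set.uIoc_of_le (by norm_num)] at ht
        have ht' : t ∈ Set.Icc (-1 : ℝ) 1 := ⟨ht.1.le, ht.2⟩
        rw [Real.norm_eq_abs, abs_mul]
        exact mul_le_mul (hG t ht') (hmax ht') (abs_nonneg _) hG0)
    norm_num at this
    linarith
  have h1 : S ^ 2 ≤ C * (G * S * 2) := by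
    have := hle q hq s₀ hs₀
    rw [← sq_abs, hsq] at this
    refine this.trans ?_
    gcongr
    exact (neg_le_abs _).trans hb
  rcases hS0.eq_or_lt with h0 | h0
  · rw [← h0]
    positivity
  · nlinarith

/-- The unnormalised Legendre polynomial of the Rodrigues formula. -/
noncomputable def rodrigues (n : ℕ) : Polynomial ℝ :=
  Polynomial.derivative^[n] ((Polynomial.X ^ 2 - 1) ^ n)

theorem eval_rodrigues_eq_zero_of_legendre_eq_zero {n : ℕ} {s : ℝ} (h : legendre n s = 0) :
    (rodrigues n).eval s = 0 := by
  have hiter : ∀ (j : ℕ) (p : Polynomial ℝ),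
      iteratedDeriv j (fun t => p.eval t) = fun t => (Polynomial.derivative^[j] p).eval t := by
    intro j
    induction j with
    | zero => intro p; simp
    | succ j ih =>
      intro p
      rw [iteratedDeriv_succ, ih, Function.iterate_succ_apply']
      ext t
      simp
  have hp := hiter n ((Polynomial.X ^ 2 - 1) ^ n)
  simp only [Polynomial.eval_pow, Polynomial.eval_sub, Polynomial.eval_X, Polynomial.eval_one]
    at hp
  simp only [legendre, hp] at h
  exact (mul_eq_zero.1 h).resolve_left (by positivity)

theorem natDegree_sq_sub_one_pow (n : ℕ) :
    ((Polynomial.X ^ 2 - 1 : Polynomial ℝ) ^ n).natDegree = n + n ∧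
      ((Polynomial.X ^ 2 - 1 : Polynomial ℝ) ^ n).Monic := by
  have hmon : (Polynomial.X ^ 2 - 1 : Polynomial ℝ).Monic := by monicity!
  have hdeg : (Polynomial.X ^ 2 - 1 : Polynomial ℝ).natDegree = 2 := by compute_degree!
  exact ⟨by rw [Polynomial.natDegree_pow, hdeg]; ring, hmon.pow n⟩

theorem natDegree_rodrigues_le (n : ℕ) : (rodrigues n).natDegree ≤ n := by
  refine (Polynomial.natDegree_iterate_derivative _ n).trans ?_
  rw [(natDegree_sq_sub_one_pow n).1, Nat.add_sub_cancel]

theorem coeff_rodrigues_ne_zero (n : ℕ) : (rodrigues n).coeff n ≠ 0 := by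
  obtain ⟨hd, hm⟩ := natDegree_sq_sub_one_pow n
  have h1 : ((Polynomial.X ^ 2 - 1 : Polynomial ℝ) ^ n).coeff (n + n) = 1 := by
    rw [← hd]
    exact hm
  rw [rodrigues, Polynomial.coeff_iterate_derivative, h1]
  simp [Nat.descFactorial_eq_zero_iff_lt]

theorem integral_rodrigues_mul_eq_zero {n : ℕ} {v : Polynomial ℝ} (hv : v.natDegree < n) :
    ∫ t in (-1 : ℝ)..1, (rodrigues n).eval t * v.eval t = 0 := by
  set F : Polynomial ℝ := (Polynomial.X ^ 2 - 1) ^ n with hF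
  have hend : ∀ j < n, (Polynomial.derivative^[j] F).eval 1 = 0 ∧
      (Polynomial.derivative^[j] F).eval (-1) = 0 := by
    intro j hj
    have hdvd := Polynomial.pow_sub_dvd_iterate_derivative_of_pow_dvd j (dvd_refl F)
    obtain ⟨r, hr⟩ := hdvd
    have hne : n - j ≠ 0 := by lia
    constructor <;> simp [hr, hne]
  suffices H : ∀ j ≤ n, ∀ v : Polynomial ℝ, v.natDegree < j →
      ∫ t in (-1 : ℝ)..1, v.eval t * (Polynomial.derivative^[j] F).eval t = 0 by
    simpa only [mul_comm, rodrigues] using H n le_rfl v hv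
  intro j
  induction j with
  | zero => intro _ v hv; lia
  | succ j ih =>
    intro hj v hv
    obtain ⟨e1, e2⟩ := hend j (by lia)
    have hparts := intervalIntegral.integral_mul_deriv_eq_deriv_mul (a := (-1 : ℝ)) (b := 1)
      (u := fun t => v.eval t) (v := fun t => (Polynomial.derivative^[j] F).eval t)
      (fun t _ => v.hasDerivAt t) (fun t _ => Polynomial.hasDerivAt _ t)
      (Continuous.intervalIntegrable (by fun_prop) _ _)
      (Continuous.intervalIntegrable (by fun_prop) _ _)
    rw [Function.iterate_succ_apply', hparts, e1, e2]
    by_cases h0 : v.natDegree = 0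
    · rw [Polynomial.eq_C_of_natDegree_eq_zero h0]
      simp
    · rw [ih (by lia) _ ((Polynomial.natDegree_derivative_lt h0).trans_le (by lia))]
      simp

theorem exists_abs_eval_legendre_root_le (m : ℕ) :
    ∃ C > 0, ∀ (q : Polynomial ℝ) (g : ℝ → ℝ) (G : ℝ), q.natDegree ≤ m + 1 → Continuous g →
      (∀ t ∈ Set.Icc (-1 : ℝ) 1, |g t| ≤ G) →
      (∀ v : Polynomial ℝ, v.natDegree ≤ m →
        ∫ t in (-1 : ℝ)..1, (q.eval t + g t) * v.eval t = 0) →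
      ∀ s ∈ Set.Icc (-1 : ℝ) 1, (q.natDegree ≤ m ∨ legendre (m + 1) s = 0) →
        |q.eval s| ≤ C * G := by
  obtain ⟨C, hC, hle⟩ := exists_abs_eval_le_of_integral_add_mul_eq_zero m
  refine ⟨C, hC, fun q g G hq hg hG horth s hs hroot => ?_⟩
  rcases hroot with hdeg | hroot
  · exact hle q g G hdeg hg hG horth s hs
  set R := rodrigues (m + 1) with hR
  set κ := q.coeff (m + 1) / R.coeff (m + 1) with hκ
  set q₀ := q - Polynomial.C κ * R with hq₀
  have hRc : R.coeff (m + 1) ≠ 0 := coeff_rodrigues_ne_zero _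
  have hq₀deg : q₀.natDegree ≤ m := by
    rw [Polynomial.natDegree_le_iff_coeff_eq_zero]
    intro N hN
    rcases (Nat.succ_le_of_lt hN).eq_or_lt with h | h
    · rw [hq₀, ← h]
      simp [hκ, hRc]
    · simp [hq₀, Polynomial.coeff_eq_zero_of_natDegree_lt (hq.trans_lt h),
        Polynomial.coeff_eq_zero_of_natDegree_lt ((natDegree_rodrigues_le (m + 1)).trans_lt h),
        hR]
  have hval : q.eval s = q₀.eval s := by
    simp [hq₀, hR, eval_rodrigues_eq_zero_of_legendre_eq_zero hroot]
  rw [hval]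
  refine hle q₀ g G hq₀deg hg hG (fun v hv => ?_) s hs
  have h0 := integral_rodrigues_mul_eq_zero (Nat.lt_succ_of_le hv)
  have hsplit : ∀ t : ℝ, (q₀.eval t + g t) * v.eval t
      = (q.eval t + g t) * v.eval t - κ * (R.eval t * v.eval t) := fun t => by
    simp only [hq₀, Polynomial.eval_sub, Polynomial.eval_mul, Polynomial.eval_C]
    ring
  simp only [hsplit]
  rw [intervalIntegral.integral_sub (Continuous.intervalIntegrable (by fun_prop) _ _)
    (Continuous.intervalIntegrable (by fun_prop) _ _), horth v hv,
    intervalIntegral.integral_const_mul, h0]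
  simp

theorem affMap_mem_Icc {p r s : ℝ} (hpr : p ≤ r) (hs : s ∈ Set.Icc (-1 : ℝ) 1) :
    affMap p r s ∈ Set.Icc p r := by
  obtain ⟨h1, h2⟩ := hs
  constructor <;> simp only [affMap] <;> nlinarith

/-- The affinely scaled form of `exists_abs_eval_legendre_root_le`. -/
theorem exists_abs_eval_affMap_le (m : ℕ) :
    ∃ C > 0, ∀ (p r : ℝ), p < r → ∀ (q : Polynomial ℝ) (g : ℝ → ℝ) (G : ℝ),
      q.natDegree ≤ m + 1 → Continuous g → (∀ t ∈ Set.Icc p r, |g t| ≤ G) →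
      (∀ v : Polynomial ℝ, v.natDegree ≤ m →
        ∫ t in p..r, (q.eval t + g t) * v.eval t = 0) →
      ∀ s ∈ Set.Icc (-1 : ℝ) 1, (q.natDegree ≤ m ∨ legendre (m + 1) s = 0) →
        |q.eval (affMap p r s)| ≤ C * G := by
  obtain ⟨C, hC, hle⟩ := exists_abs_eval_legendre_root_le m
  refine ⟨C, hC, fun p r hpr q g G hq hg hG horth s hs hroot => ?_⟩
  have hℓ : 0 < (r - p) / 2 := by linarith
  set ℓ := (r - p) / 2 with hℓdef
  set c := (p + r) / 2 with hc
  have haff : ∀ t, affMap p r t = ℓ * t + c := fun t => by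
    simp only [affMap, hℓdef, hc]
    ring
  set A : Polynomial ℝ := Polynomial.C ℓ * Polynomial.X + Polynomial.C c with hA
  set B : Polynomial ℝ := Polynomial.C ℓ⁻¹ * Polynomial.X + Polynomial.C (-ℓ⁻¹ * c) with hB
  have hAd : A.natDegree ≤ 1 := Polynomial.natDegree_linear_le
  have hBd : B.natDegree ≤ 1 := Polynomial.natDegree_linear_le
  have hcomp : ∀ w D : Polynomial ℝ, D.natDegree ≤ 1 → (w.comp D).natDegree ≤ w.natDegree :=
    fun w D hD => Polynomial.natDegree_comp_le.trans
      ((Nat.mul_le_mul_left _ hD).trans_eq (mul_one _))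
  have hAe : ∀ t, (q.comp A).eval t = q.eval (ℓ * t + c) := fun t => by simp [hA]
  have key := hle (q.comp A) (fun t => g (ℓ * t + c)) G ((hcomp _ _ hAd).trans hq)
    (by fun_prop) (fun t ht => by
      rw [← haff]
      exact hG _ (affMap_mem_Icc hpr.le ht)) (fun v hv => by
      have h1 := horth (v.comp B) ((hcomp _ _ hBd).trans hv)
      have h2 := intervalIntegral.integral_comp_mul_add (a := (-1 : ℝ)) (b := 1)
        (fun t => (q.eval t + g t) * (v.comp B).eval t) hℓ.ne' c
      have e1 : ℓ * -1 + c = p := by simp only [hℓdef, hc]; ring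
      have e2 : ℓ * 1 + c = r := by simp only [hℓdef, hc]; ring
      rw [e1, e2, h1, smul_zero] at h2
      rw [← h2]
      congr 1
      ext t
      have : ℓ⁻¹ * (ℓ * t + c) + -ℓ⁻¹ * c = t := by
        field_simp
        ring
      simp only [hAe, Polynomial.eval_comp, hB, Polynomial.eval_add, Polynomial.eval_mul,
        Polynomial.eval_C, Polynomial.eval_X, this]) s hs
    (hroot.imp_left fun h => (hcomp _ _ hAd).trans h)
  rwa [hAe, ← haff] at key

/-- Taylor approximation on `[p,r]` by a polynomial of degree at most `n`. -/
theorem exists_natDegree_le_abs_sub_eval_le {f : ℝ → ℝ} {n : ℕ} {M p r : ℝ} (hpr : p < r)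
    (hf : ContDiff ℝ (n + 1) f) (hM : ∀ t ∈ Set.Icc p r, |iteratedDeriv (n + 1) f t| ≤ M) :
    ∃ T : Polynomial ℝ, T.natDegree ≤ n ∧
      ∀ t ∈ Set.Icc p r, |f t - T.eval t| ≤ M * (r - p) ^ (n + 1) := by
  have hM0 : 0 ≤ M := (abs_nonneg _).trans (hM p (Set.left_mem_Icc.2 hpr.le))
  refine ⟨∑ j ∈ Finset.range (n + 1), Polynomial.C ((j.factorial : ℝ)⁻¹ *
    iteratedDerivWithin j f (Set.Icc p r) p) * (Polynomial.X - Polynomial.C p) ^ j, ?_, ?_⟩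
  · refine Polynomial.natDegree_sum_le_of_forall_le _ _ fun j hj => ?_
    refine (Polynomial.natDegree_C_mul_le _ _).trans ?_
    rw [Polynomial.natDegree_pow, Polynomial.natDegree_X_sub_C]
    have := Finset.mem_range.1 hj
    lia
  · intro t ht
    have hrem := taylor_mean_remainder_bound hpr.le hf.contDiffOn ht (C := M) (fun y hy => by
      rw [iteratedDerivWithin_eq_iteratedDeriv (uniqueDiffOn_Icc hpr)
        (by exact_mod_cast hf.contDiffAt) hy]
      exact hM y hy)
    rw [taylor_within_apply] at hrem
    have heq : (∑ j ∈ Finset.range (n + 1), Polynomial.C ((j.factorial : ℝ)⁻¹ *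
        iteratedDerivWithin j f (Set.Icc p r) p) * (Polynomial.X - Polynomial.C p) ^ j).eval t
        = ∑ j ∈ Finset.range (n + 1), ((j.factorial : ℝ)⁻¹ * (t - p) ^ j) •
          iteratedDerivWithin j f (Set.Icc p r) p := by
      rw [Polynomial.eval_finsetSum]
      refine Finset.sum_congr rfl fun j _ => ?_
      simp only [Polynomial.eval_mul, Polynomial.eval_C, Polynomial.eval_pow,
        Polynomial.eval_sub, Polynomial.eval_X, smul_eq_mul]
      ring
    rw [heq]
    refine hrem.trans ((div_le_self ?_ ?_).trans ?_)
    · exact mul_nonneg hM0 (pow_nonneg (by linarith [ht.1]) _)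
    · exact_mod_cast Nat.one_le_iff_ne_zero.2 (Nat.factorial_ne_zero n)
    · have h1 : 0 ≤ t - p := by linarith [ht.1]
      have h2 : t - p ≤ r - p := by linarith [ht.2]
      gcongr

theorem abs_sub_le_of_forall_hasDerivAt {F F' : ℝ → ℝ} {A p r : ℝ}
    (hF : ∀ t, HasDerivAt F (F' t) t) (hA : ∀ t ∈ Set.Icc p r, |F' t| ≤ A) :
    ∀ t ∈ Set.Icc p r, |F t - F p| ≤ A * (t - p) := by
  intro t ht
  have h := Convex.norm_image_sub_le_of_norm_hasDerivWithin_le (s := Set.Icc p r)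
    (fun y _ => (hF y).hasDerivWithinAt) hA (convex_Icc p r)
    (Set.left_mem_Icc.2 (ht.1.trans ht.2)) ht
  rwa [Real.norm_eq_abs, Real.norm_eq_abs, abs_of_nonneg (sub_nonneg.2 ht.1)] at h

theorem mesh_abs_sub_le {N : ℕ} {x : ℕ → ℝ} {F : ℕ → ℝ → ℝ} {A : ℝ}
    (hstep : ∀ i ∈ Finset.Icc 1 N, |F i (x i) - F i (x (i - 1))| ≤ A * (x i - x (i - 1)))
    (hglue : ∀ i ∈ Finset.Icc 1 (N - 1), F i (x i) = F (i + 1) (x i)) :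
    ∀ i ∈ Finset.Icc 1 N, |F i (x (i - 1)) - F 1 (x 0)| ≤ A * (x (i - 1) - x 0) := by
  intro i hi
  obtain ⟨h1, hN⟩ := Finset.mem_Icc.1 hi
  clear hi
  induction i, h1 using Nat.le_induction with
  | base => simp
  | succ i h1 ih =>
    have hs := hstep i (Finset.mem_Icc.2 ⟨h1, by lia⟩)
    have hg := hglue i (Finset.mem_Icc.2 ⟨h1, by lia⟩)
    have hi := ih (by lia)
    rw [Nat.add_sub_cancel, ← hg]
    have := abs_sub_le (F i (x i)) (F i (x (i - 1))) (F 1 (x 0))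
    linarith

theorem mesh_pos_of_forall_lt {N : ℕ} {x : ℕ → ℝ} {F : ℕ → ℝ → ℝ} (hN : 1 ≤ N)
    (hstep : ∀ i ∈ Finset.Icc 1 N, F i (x (i - 1)) < F i (x i))
    (hglue : ∀ i ∈ Finset.Icc 1 (N - 1), F i (x i) = F (i + 1) (x i)) (h0 : F 1 (x 0) = 0) :
    0 < F N (x N) := by
  suffices H : ∀ i, 1 ≤ i → i ≤ N → 0 < F i (x i) from H N hN le_rfl
  intro i h1 hiN
  induction i, h1 using Nat.le_induction with
  | base => simpa [h0] using hstep 1 (Finset.mem_Icc.2 ⟨le_rfl, hN⟩)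
  | succ i h1 ih =>
    have hs := hstep (i + 1) (Finset.mem_Icc.2 ⟨by lia, hiN⟩)
    rw [Nat.add_sub_cancel, ← hglue i (Finset.mem_Icc.2 ⟨h1, by lia⟩)] at hs
    exact (ih (by lia)).trans hs

theorem IsMesh.le_of_le {a b : ℝ} {N : ℕ} {x : ℕ → ℝ} (hx : IsMesh a b N x) {i j : ℕ}
    (hij : i ≤ j) (hj : j ≤ N) : x i ≤ x j := by
  induction j, hij using Nat.le_induction with
  | base => exact le_rfl
  | succ j hij ih => exact (ih (by lia)).trans (hx.2.2.2 j (by lia)).le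

theorem IsMesh.element {a b : ℝ} {N : ℕ} {x : ℕ → ℝ} (hx : IsMesh a b N x) {i : ℕ}
    (hi : i ∈ Finset.Icc 1 N) : a ≤ x (i - 1) ∧ x (i - 1) < x i ∧ x i ≤ b := by
  obtain ⟨h1, hN⟩ := Finset.mem_Icc.1 hi
  refine ⟨?_, ?_, ?_⟩
  · rw [← hx.2.1]
    exact hx.le_of_le (Nat.zero_le _) (by lia)
  · have := hx.2.2.2 (i - 1) (by lia)
    rwa [Nat.sub_add_cancel h1] at this
  · rw [← hx.2.2.1]
    exact hx.le_of_le hN le_rfl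

theorem exp_mul_le_exp_abs_mul {κ y d : ℝ} (hy : 0 ≤ y) (hyd : y ≤ d) :
    Real.exp (κ * y) ≤ Real.exp (|κ| * d) := by
  apply Real.exp_le_exp.2
  calc κ * y ≤ |κ| * y := by gcongr; exact le_abs_self κ
    _ ≤ |κ| * d := by gcongr

/-- If `w' = μ w + s` with `s` of mean zero on a short interval, then `exp (-μ t) w` is almost
constant there. -/
theorem abs_exp_mul_sub_le {μ a d p r h ρ : ℝ} (hap : a ≤ p) (hpr : p < r) (hrd : r ≤ a + d)
    (hh : r - p ≤ h) {w s : ℝ → ℝ} (hs : Continuous s)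
    (hw : ∀ t, HasDerivAt w (μ * w t + s t) t) (hmean : ∫ t in p..r, s t = 0)
    (hρ : ∀ t ∈ Set.Icc p r, |s t| ≤ ρ) :
    |Real.exp (-μ * (r - a)) * w r - Real.exp (-μ * (p - a)) * w p|
        ≤ |μ| * (Real.exp (|μ| * d) * (h * ρ)) * (r - p) ∧
      ∀ t ∈ Set.Icc p r, |Real.exp (-μ * (t - a)) * w t - Real.exp (-μ * (p - a)) * w p|
        ≤ |μ| * (Real.exp (|μ| * d) * (h * ρ)) * (t - p) + Real.exp (|μ| * d) * (h * ρ) := by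
  set K := Real.exp (|μ| * d) with hK
  set Z : ℝ → ℝ := fun t => ∫ y in p..t, s y with hZ
  have hρ0 : 0 ≤ ρ := (abs_nonneg _).trans (hρ p (Set.left_mem_Icc.2 hpr.le))
  have hZd : ∀ t, HasDerivAt Z (s t) t := fun t =>
    intervalIntegral.integral_hasDerivAt_right (hs.intervalIntegrable _ _)
      hs.aestronglyMeasurable.stronglyMeasurableAtFilter hs.continuousAt
  have hZp : Z p = 0 := by simp [hZ]
  have hZb : ∀ t ∈ Set.Icc p r, |Z t| ≤ h * ρ := by
    intro t ht
    have h1 := abs_sub_le_of_forall_hasDerivAt hZd hρ t ht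
    rw [hZp, sub_zero] at h1
    have h2 : t - p ≤ h := by linarith [ht.2]
    nlinarith
  have hE : ∀ t, HasDerivAt (fun t => Real.exp (-μ * (t - a)))
      (Real.exp (-μ * (t - a)) * -μ) t := fun t => by
    have h1 : HasDerivAt (fun t : ℝ => -μ * (t - a)) (-μ) t := by
      simpa using ((hasDerivAt_id t).sub_const a).const_mul (-μ)
    exact h1.exp
  have hEb : ∀ t ∈ Set.Icc p r, Real.exp (-μ * (t - a)) ≤ K := fun t ht => by
    have := exp_mul_le_exp_abs_mul (κ := -μ) (y := t - a) (d := d) (by linarith [ht.1])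
      (by linarith [ht.2])
    rwa [abs_neg] at this
  have hmain := abs_sub_le_of_forall_hasDerivAt (p := p) (r := r) (A := |μ| * (K * (h * ρ)))
    (F := fun t => Real.exp (-μ * (t - a)) * w t - Real.exp (-μ * (t - a)) * Z t)
    (F' := fun t => μ * (Real.exp (-μ * (t - a)) * Z t))
    (fun t => (((hE t).mul (hw t)).sub ((hE t).mul (hZd t))).congr_deriv (by ring))
    (fun t ht => by
      rw [abs_mul, abs_mul, Real.abs_exp]
      exact mul_le_mul_of_nonneg_left (mul_le_mul (hEb t ht) (hZb t ht) (abs_nonneg _)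
        (Real.exp_pos _).le) (abs_nonneg _))
  simp only [hZp, mul_zero, sub_zero] at hmain
  constructor
  · have h1 := hmain r (Set.right_mem_Icc.2 hpr.le)
    have h2 : Z r = 0 := hmean
    rwa [h2, mul_zero, sub_zero] at h1
  · intro t ht
    have h1 := hmain t ht
    have h2 : |Real.exp (-μ * (t - a)) * Z t| ≤ K * (h * ρ) := by
      rw [abs_mul, Real.abs_exp]
      exact mul_le_mul (hEb t ht) (hZb t ht) (abs_nonneg _) (Real.exp_pos _).le
    rw [abs_le] at h1 h2 ⊢
    constructor <;> linarith [h1.1, h1.2, h2.1, h2.2]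

/-- Stability of the Dirichlet problem for `(D - μ)(D - ν)` on a mesh: a right-hand side of mean
zero on every element gives a piecewise `C²`, globally `C¹` solution which is smaller by a factor
`h`, together with its derivative. -/
theorem exists_abs_le_of_forall_integral_eq_zero (μ ν d : ℝ) (hd : 0 < d) :
    ∃ C > 0, ∀ (a b : ℝ), b - a = d → ∀ (N : ℕ) (x : ℕ → ℝ) (h : ℝ), IsMesh a b N x →
      (∀ i ∈ Finset.Icc 1 N, x i - x (i - 1) ≤ h) →
      ∀ e e' e'' : ℕ → ℝ → ℝ, (∀ i t, HasDerivAt (e i) (e' i t) t) →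
      (∀ i t, HasDerivAt (e' i) (e'' i t) t) → (∀ i, Continuous (e'' i)) →
      (∀ i ∈ Finset.Icc 1 (N - 1), e i (x i) = e (i + 1) (x i)) →
      (∀ i ∈ Finset.Icc 1 (N - 1), e' i (x i) = e' (i + 1) (x i)) →
      e 1 (x 0) = 0 → e N (x N) = 0 →
      ∀ ρ : ℝ, (∀ i ∈ Finset.Icc 1 N,
        ∫ t in x (i - 1)..x i, (e'' i t - (μ + ν) * e' i t + μ * ν * e i t) = 0) →
      (∀ i ∈ Finset.Icc 1 N, ∀ t ∈ Set.Icc (x (i - 1)) (x i),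
        |e'' i t - (μ + ν) * e' i t + μ * ν * e i t| ≤ ρ) →
      ∀ i ∈ Finset.Icc 1 N, ∀ t ∈ Set.Icc (x (i - 1)) (x i),
        |e i t| ≤ C * (h * ρ) ∧ |e' i t| ≤ C * (h * ρ) := by
  set K := Real.exp (|μ| * d) with hK
  set K₁ := Real.exp (|μ - ν| * d) with hK₁
  set K₂ := Real.exp (|ν| * d) with hK₂
  set Λ := (|μ| * d + 1) * K with hΛ
  have hΛ0 : 0 < Λ := by positivity
  refine ⟨K * (2 * Λ) + (|ν| + 1) * (K₂ * (K₁ * (2 * Λ) * d)), by positivity, ?_⟩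
  intro a b hab N x h hx hh e e' e'' he he' hcont hg hg' hl hr ρ hmean hρ
  have hN := hx.1
  have h1N : 1 ∈ Finset.Icc 1 N := Finset.mem_Icc.2 ⟨le_rfl, hN⟩
  have hh0 : 0 ≤ h := by
    have := hh 1 h1N
    linarith [(hx.element h1N).2.1]
  have hρ0 : 0 ≤ ρ := (abs_nonneg _).trans
    (hρ 1 h1N (x (1 - 1)) (Set.left_mem_Icc.2 (hx.element h1N).2.1.le))
  set w : ℕ → ℝ → ℝ := fun i t => e' i t - ν * e i t with hw
  set Y : ℕ → ℝ → ℝ := fun i t => Real.exp (-μ * (t - a)) * w i t with hY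
  set v : ℕ → ℝ → ℝ := fun i t => Real.exp (-ν * (t - a)) * e i t with hv
  set B := |μ| * (K * (h * ρ)) with hB
  have hB0 : 0 ≤ B := by positivity
  have hce : ∀ i, Continuous (e i) := fun i =>
    continuous_iff_continuousAt.2 fun t => (he i t).continuousAt
  have hce' : ∀ i, Continuous (e' i) := fun i =>
    continuous_iff_continuousAt.2 fun t => (he' i t).continuousAt
  have hloc := fun i hi => by
    obtain ⟨h1, h2, h3⟩ := hx.element (i := i) hi
    exact abs_exp_mul_sub_le (μ := μ) (d := d) (w := w i)
      (s := fun t => e'' i t - (μ + ν) * e' i t + μ * ν * e i t) h1 h2 (by linarith) (hh i hi)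
      (by have := hce i; have := hce' i; have := hcont i; fun_prop)
      (fun t => ((he' i t).sub ((he i t).const_mul ν)).congr_deriv (by simp only [hw]; ring))
      (hmean i hi) (hρ i hi)
  have hnode := mesh_abs_sub_le (F := Y) (fun i hi => (hloc i hi).1) (fun i hi => by
    simp only [hY, hw, hg i hi, hg' i hi])
  set Y₀ := Y 1 (x 0) with hY₀
  have hYb : ∀ i ∈ Finset.Icc 1 N, ∀ t ∈ Set.Icc (x (i - 1)) (x i),
      |Y i t - Y₀| ≤ Λ * (h * ρ) := by
    intro i hi t ht
    obtain ⟨h1, h2, h3⟩ := hx.element hi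
    have e1 := hnode i hi
    have e2 := (hloc i hi).2 t ht
    have e3 := abs_sub_le (Y i t) (Y i (x (i - 1))) Y₀
    have e4 : B * (t - x 0) ≤ B * d := by
      have : t - x 0 ≤ d := by rw [hx.2.1]; linarith [ht.2]
      gcongr
    have e5 : Λ * (h * ρ) = B * d + K * (h * ρ) := by simp only [hΛ, hB]; ring
    change |Y i t - Y i (x (i - 1))| ≤ _ at e2
    rw [e5]
    linarith
  have hvd : ∀ i t, HasDerivAt (v i) (Real.exp ((μ - ν) * (t - a)) * Y i t) t := by
    intro i t
    have h1 : HasDerivAt (fun t : ℝ => -ν * (t - a)) (-ν) t := by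
      simpa using ((hasDerivAt_id t).sub_const a).const_mul (-ν)
    refine (h1.exp.mul (he i t)).congr_deriv ?_
    have h2 : Real.exp (-ν * (t - a))
        = Real.exp ((μ - ν) * (t - a)) * Real.exp (-μ * (t - a)) := by
      rw [← Real.exp_add]
      ring_nf
    simp only [hY, hw, h2]
    ring
  have hvglue : ∀ i ∈ Finset.Icc 1 (N - 1), v i (x i) = v (i + 1) (x i) := fun i hi => by
    simp only [hv, hg i hi]
  have hvl : v 1 (x 0) = 0 := by simp [hv, hl]
  have hvr : v N (x N) = 0 := by simp [hv, hr]
  have hsign : ∀ σ : ℝ, σ * Y₀ ≤ |σ| * (Λ * (h * ρ)) := by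
    intro σ
    by_contra! hlt
    have hpos := mesh_pos_of_forall_lt (x := x) (F := fun i t => σ * v i t) hN
      (fun i hi => by
        obtain ⟨h1, h2, h3⟩ := hx.element hi
        have hmono : StrictMonoOn (fun t => σ * v i t) (Set.Icc (x (i - 1)) (x i)) := by
          refine strictMonoOn_of_deriv_pos (convex_Icc _ _)
            (fun t _ => ((hvd i t).const_mul σ).continuousAt.continuousWithinAt)
            fun t ht => ?_
          rw [((hvd i t).const_mul σ).deriv]
          have e1 := hYb i hi t (interior_subset ht)
          have e2 : |σ * (Y i t - Y₀)| ≤ |σ| * (Λ * (h * ρ)) := by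
            rw [abs_mul]
            gcongr
          have e3 : 0 < σ * Y i t := by linarith [(abs_le.1 e2).1]
          have e4 := mul_pos (Real.exp_pos ((μ - ν) * (t - a))) e3
          linarith
        exact hmono (Set.left_mem_Icc.2 h2.le) (Set.right_mem_Icc.2 h2.le) h2)
      (fun i hi => by simp only [hvglue i hi]) (by simp [hvl])
    simp [hvr] at hpos
  have hY₀b : |Y₀| ≤ Λ * (h * ρ) := by
    have e1 := hsign 1
    have e2 := hsign (-1)
    norm_num at e1 e2
    exact abs_le.2 ⟨by linarith, e1⟩
  have hY2 : ∀ i ∈ Finset.Icc 1 N, ∀ t ∈ Set.Icc (x (i - 1)) (x i),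
      |Y i t| ≤ 2 * Λ * (h * ρ) := by
    intro i hi t ht
    have e1 := hYb i hi t ht
    have e2 := abs_sub_abs_le_abs_sub (Y i t) Y₀
    linarith
  set A := K₁ * (2 * Λ * (h * ρ)) with hA
  have hA0 : 0 ≤ A := by positivity
  have hvloc : ∀ i ∈ Finset.Icc 1 N, ∀ t ∈ Set.Icc (x (i - 1)) (x i),
      |v i t - v i (x (i - 1))| ≤ A * (t - x (i - 1)) := by
    intro i hi
    obtain ⟨h1, h2, h3⟩ := hx.element hi
    refine abs_sub_le_of_forall_hasDerivAt (hvd i) fun t ht => ?_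
    rw [abs_mul, Real.abs_exp]
    exact mul_le_mul (exp_mul_le_exp_abs_mul (by linarith [ht.1]) (by linarith [ht.2]))
      (hY2 i hi t ht) (abs_nonneg _) (Real.exp_pos _).le
  have hvnode := mesh_abs_sub_le (F := v) (fun i hi =>
    hvloc i hi (x i) (Set.right_mem_Icc.2 (hx.element hi).2.1.le)) hvglue
  intro i hi t ht
  obtain ⟨h1, h2, h3⟩ := hx.element hi
  have hta : 0 ≤ t - a := by linarith [ht.1]
  have htd : t - a ≤ d := by linarith [ht.2]
  have hvt : |v i t| ≤ A * d := by
    have e1 := hvloc i hi t ht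
    have e2 := hvnode i hi
    have e3 := abs_add_le (v i t - v i (x (i - 1))) (v i (x (i - 1)) - v 1 (x 0))
    rw [hvl, sub_zero, sub_add_cancel] at e3
    rw [hvl, sub_zero] at e2
    have e4 : A * (t - x 0) ≤ A * d := by
      rw [hx.2.1]
      gcongr
    linarith
  have het : |e i t| ≤ K₂ * (A * d) := by
    have e1 : e i t = Real.exp (ν * (t - a)) * v i t := by
      simp only [hv]
      rw [← mul_assoc, ← Real.exp_add]
      simp
    rw [e1, abs_mul, Real.abs_exp]
    exact mul_le_mul (exp_mul_le_exp_abs_mul hta htd) hvt (abs_nonneg _) (Real.exp_pos _).le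
  have hwt : |w i t| ≤ K * (2 * Λ * (h * ρ)) := by
    have e1 : w i t = Real.exp (μ * (t - a)) * Y i t := by
      simp only [hY]
      rw [← mul_assoc, ← Real.exp_add]
      simp
    rw [e1, abs_mul, Real.abs_exp]
    exact mul_le_mul (exp_mul_le_exp_abs_mul hta htd) (hY2 i hi t ht) (abs_nonneg _)
      (Real.exp_pos _).le
  have hsum : (K * (2 * Λ) + (|ν| + 1) * (K₂ * (K₁ * (2 * Λ) * d))) * (h * ρ)
      = K * (2 * Λ * (h * ρ)) + |ν| * (K₂ * (A * d)) + K₂ * (A * d) := by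
    simp only [hA]
    ring
  have hn1 : 0 ≤ K * (2 * Λ * (h * ρ)) := by positivity
  have hn2 : 0 ≤ |ν| * (K₂ * (A * d)) := by positivity
  have hn3 : 0 ≤ K₂ * (A * d) := by positivity
  rw [hsum]
  refine ⟨by linarith, ?_⟩
  have e1 : e' i t = w i t + ν * e i t := by simp only [hw]; ring
  have e2 : |ν * e i t| ≤ |ν| * (K₂ * (A * d)) := by
    rw [abs_mul]
    gcongr
  rw [e1]
  have := abs_add_le (w i t) (ν * e i t)
  linarith

theorem exists_affMap_eq {p r t : ℝ} (hpr : p < r) (ht : t ∈ Set.Icc p r) :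
    ∃ s ∈ Set.Icc (-1 : ℝ) 1, affMap p r s = t := by
  have h0 : 0 < r - p := sub_pos.2 hpr
  obtain ⟨h1, h2⟩ := ht
  refine ⟨(2 * t - p - r) / (r - p), ⟨?_, ?_⟩, ?_⟩
  · rw [le_div_iff₀ h0]; linarith
  · rw [div_le_iff₀ h0]; linarith
  · simp only [affMap]
    field_simp
    ring

theorem iteratedDeriv_iteratedDeriv_two (u : ℝ → ℝ) (j : ℕ) :
    iteratedDeriv j (iteratedDeriv 2 u) = iteratedDeriv (j + 2) u := by
  simp only [iteratedDeriv_eq_iterate, Function.iterate_add_apply]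

/-- The Petrov–Galerkin equations, tested on a single element. -/
theorem IsPGSol.integral_element_eq {k N : ℕ} {x : ℕ → ℝ} {α β γ : ℝ} {f : ℝ → ℝ}
    {P : ℕ → Polynomial ℝ} (hP : IsPGSol k N x α β γ f P) {i : ℕ} (hi : i ∈ Finset.Icc 1 N)
    {v : Polynomial ℝ} (hv : v.natDegree ≤ k - 2) :
    ∫ t in x (i - 1)..x i,
        (-α * ((Polynomial.derivative (Polynomial.derivative (P i))).eval t)
          + β * ((Polynomial.derivative (P i)).eval t) + γ * (P i).eval t) * v.eval t
      = ∫ t in x (i - 1)..x i, f t * v.eval t := by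
  have h := hP.2 (fun j => if j = i then v else 0) (fun j _ => by
    split_ifs
    · exact hv
    · simp)
  rw [Finset.sum_eq_single_of_mem i hi (fun j _ hj => by simp [hj]),
    Finset.sum_eq_single_of_mem i hi (fun j _ hj => by simp [hj])] at h
  simpa using h

theorem abs_le_on_Icc_of_Ioo {g : ℝ → ℝ} (hg : Continuous g) {a b M : ℝ} (hab : a < b)
    (hM : ∀ y ∈ Set.Ioo a b, |g y| ≤ M) : ∀ y ∈ Set.Icc a b, |g y| ≤ M := by
  rw [← closure_Ioo hab.ne]
  exact fun y hy => closure_minimal hM (isClosed_le hg.abs continuous_const) hy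

/-- A family of quantities is bounded by `2 * Q` if every bound `B` for it improves to
`Q + B / 2`. -/
theorem le_two_mul_of_forall_improve {ι : Type*} {f : ι → ℝ} {Q B₀ : ℝ} (hB₀ : ∀ j, f j ≤ B₀)
    (himp : ∀ B, (∀ j, f j ≤ B) → ∀ j, f j ≤ Q + B / 2) (j : ι) : f j ≤ 2 * Q := by
  have : Nonempty ι := ⟨j⟩
  have hbdd : BddAbove (Set.range f) := ⟨B₀, by rintro _ ⟨j, rfl⟩; exact hB₀ j⟩
  have h1 : ⨆ j, f j ≤ Q + (⨆ j, f j) / 2 := ciSup_le (himp _ (le_ciSup hbdd))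
  have h2 := le_ciSup hbdd j
  linarith

/-- Superconvergence of the second derivative of the Petrov–Galerkin solution at the Gauss
points (images of the roots of `L_{k-1}`), second derivatives of `u_h` taken elementwise:
`|(u - u_h)''(g_{in})| ≤ C h^k ‖u‖_{k+2,∞}`. -/
theorem petrov_galerkin_superconvergence_gauss_points (k : ℕ) (hk : 3 ≤ k)
    (α β γ c d : ℝ) (hα : 0 < α) (hγ : 0 ≤ γ) (hc : 1 ≤ c) (hd : 0 < d) :
    ∃ C > 0, ∃ h₀ > 0, ∀ (a b : ℝ), b - a = d →
      ∀ (N : ℕ) (x : ℕ → ℝ) (h : ℝ),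
        IsMesh a b N x → IsMeshSize N x h → IsQuasiUniform N x h c → h ≤ h₀ →
      ∀ u : ℝ → ℝ, ContDiff ℝ (k + 2) u → u a = 0 → u b = 0 →
      ∀ P : ℕ → Polynomial ℝ,
        IsPGSol k N x α β γ (fun t => -α * iteratedDeriv 2 u t + β * deriv u t + γ * u t) P →
      ∀ M : ℝ, (∀ j ≤ k + 2, ∀ y ∈ Set.Ioo a b, |iteratedDeriv j u y| ≤ M) →
        ∀ i ∈ Finset.Icc 1 N, ∀ s ∈ Set.Ioo (-1 : ℝ) 1, legendre (k - 1) s = 0 →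
          |iteratedDeriv 2 u (affMap (x (i - 1)) (x i) s)
              - (Polynomial.derivative (Polynomial.derivative (P i))).eval
                  (affMap (x (i - 1)) (x i) s)|
            ≤ C * h ^ k * M := by
  obtain ⟨m, rfl⟩ : ∃ m, k = m + 2 := ⟨k - 2, by lia⟩
  obtain ⟨C₁, hC₁, hloc⟩ := exists_abs_eval_affMap_le m
  obtain ⟨μ, ν, hsum, hprod⟩ : ∃ μ ν : ℝ, μ + ν = β / α ∧ μ * ν = -(γ / α) := by
    refine ⟨(β + √(β ^ 2 + 4 * α * γ)) / (2 * α), (β - √(β ^ 2 + 4 * α * γ)) / (2 * α), ?_, ?_⟩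
    · field_simp
      ring
    · have hsq : √(β ^ 2 + 4 * α * γ) ^ 2 = β ^ 2 + 4 * α * γ := Real.sq_sqrt (by positivity)
      field_simp
      linarith
  obtain ⟨C₂, hC₂, hstab⟩ := exists_abs_le_of_forall_integral_eq_zero μ ν d hd
  set κ := |μ + ν| + |μ * ν| with hκ
  have hκ0 : 0 ≤ κ := by positivity
  set D := C₁ + 1 with hD
  have hD0 : 0 < D := by positivity
  refine ⟨C₁ * (1 + κ * (2 * (C₂ * D))) + 1, by positivity, 1 / (2 * (C₂ * D * (κ + 1))),
    by positivity, ?_⟩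
  intro a b hab N x h hx hsize _ hh u hu hua hub P hP M hM i hi s hs hroot
  have hN := hx.1
  have h1N : 1 ∈ Finset.Icc 1 N := Finset.mem_Icc.2 ⟨le_rfl, hN⟩
  have hh0 : 0 ≤ h := by
    have := hsize.1 1 h1N
    linarith [(hx.element h1N).2.1]
  have hab' : a < b := by linarith
  have hu' : ContDiff ℝ ((m + 2 + 2 : ℕ) : ℕ∞) u := by exact_mod_cast hu
  have hM' : ∀ j ≤ m + 2 + 2, ∀ y ∈ Set.Icc a b, |iteratedDeriv j u y| ≤ M := fun j hj =>
    abs_le_on_Icc_of_Ioo (hu'.continuous_iteratedDeriv j (by exact_mod_cast hj)) hab' (hM j hj)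
  have hM0 : 0 ≤ M := (abs_nonneg _).trans (hM' 0 (by lia) a (Set.left_mem_Icc.2 hab'.le))
  have hu2 : ContDiff ℝ ((m + 2 : ℕ) : ℕ∞) (iteratedDeriv 2 u) := by
    rw [iteratedDeriv_eq_iterate]
    exact ContDiff.iterate_deriv' (m + 2) 2 (by exact_mod_cast hu')
  have hud : ∀ t, HasDerivAt u (deriv u t) t := fun t =>
    ((hu'.differentiable (by simp)) t).hasDerivAt
  have hud' : ∀ t, HasDerivAt (deriv u) (iteratedDeriv 2 u t) t := by
    have h1 : ContDiff ℝ ((m + 2 + 1 : ℕ) : ℕ∞) (deriv^[1] u) :=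
      ContDiff.iterate_deriv' (m + 2 + 1) 1 (by exact_mod_cast hu')
    intro t
    rw [iteratedDeriv_succ, iteratedDeriv_one]
    exact ((h1.differentiable (by simp)) t).hasDerivAt
  set e : ℕ → ℝ → ℝ := fun i t => u t - (P i).eval t with he
  set e' : ℕ → ℝ → ℝ := fun i t => deriv u t - (Polynomial.derivative (P i)).eval t with he'
  set e'' : ℕ → ℝ → ℝ := fun i t => iteratedDeriv 2 u t -
    (Polynomial.derivative (Polynomial.derivative (P i))).eval t with he''
  have hde : ∀ i t, HasDerivAt (e i) (e' i t) t := fun i t => (hud t).sub ((P i).hasDerivAt t)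
  have hde' : ∀ i t, HasDerivAt (e' i) (e'' i t) t := fun i t =>
    (hud' t).sub ((Polynomial.derivative (P i)).hasDerivAt t)
  have hcu : Continuous u := hu'.continuous
  have hcu' : Continuous (deriv u) :=
    continuous_iff_continuousAt.2 fun t => (hud' t).continuousAt
  have hcu'' : Continuous (iteratedDeriv 2 u) := hu2.continuous
  have hce : ∀ i, Continuous (e i) := fun i => by fun_prop
  have hce' : ∀ i, Continuous (e' i) := fun i => by fun_prop
  have hce'' : ∀ i, Continuous (e'' i) := fun i => by fun_prop
  have horth : ∀ i ∈ Finset.Icc 1 N, ∀ v : Polynomial ℝ, v.natDegree ≤ m →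
      ∫ t in x (i - 1)..x i, (e'' i t - (μ + ν) * e' i t + μ * ν * e i t) * v.eval t = 0 := by
    intro i hi v hv
    have h1 := hP.integral_element_eq hi (v := v) (by simpa using hv)
    rw [eq_comm, ← sub_eq_zero, ← intervalIntegral.integral_sub
      (Continuous.intervalIntegrable (by fun_prop) _ _)
      (Continuous.intervalIntegrable (by fun_prop) _ _)] at h1
    rw [← mul_zero (-(1 / α)), ← h1, ← intervalIntegral.integral_const_mul]
    congr 1
    ext t
    simp only [hsum, hprod, he, he', he'']
    field_simp
    ring
  have hPdeg : ∀ i ∈ Finset.Icc 1 N,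
      (Polynomial.derivative (Polynomial.derivative (P i))).natDegree ≤ m := fun i hi => by
    have h1 := Polynomial.natDegree_derivative_le (P i)
    have h2 := Polynomial.natDegree_derivative_le (Polynomial.derivative (P i))
    have h3 := hP.1.1 i hi
    lia
  have hest : ∀ i ∈ Finset.Icc 1 N, ∀ B ε : ℝ,
      (∀ t ∈ Set.Icc (x (i - 1)) (x i), |e i t| ≤ B ∧ |e' i t| ≤ B) →
      ∀ T : Polynomial ℝ, T.natDegree ≤ m + 1 →
      (∀ t ∈ Set.Icc (x (i - 1)) (x i), |iteratedDeriv 2 u t - T.eval t| ≤ ε) →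
      ∀ s ∈ Set.Icc (-1 : ℝ) 1, (T.natDegree ≤ m ∨ legendre (m + 1) s = 0) →
        |e'' i (affMap (x (i - 1)) (x i) s)| ≤ C₁ * (ε + κ * B) + ε := by
    intro i hi B ε hB T hT hε s hs hroot
    have hlt := (hx.element hi).2.1
    have h1 := hloc _ _ hlt (T - Polynomial.derivative (Polynomial.derivative (P i)))
      (fun t => iteratedDeriv 2 u t - T.eval t - (μ + ν) * e' i t + μ * ν * e i t) (ε + κ * B)
      ((Polynomial.natDegree_sub_le_of_le hT (hPdeg i hi)).trans (by lia)) (by fun_prop)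
      (fun t ht => by
        have h2 := hε t ht
        obtain ⟨h3, h4⟩ := hB t ht
        have h5 : |(μ + ν) * e' i t| ≤ |μ + ν| * B := by rw [abs_mul]; gcongr
        have h6 : |μ * ν * e i t| ≤ |μ * ν| * B := by rw [abs_mul]; gcongr
        rw [hκ, add_mul]
        rw [abs_le] at h2 h5 h6 ⊢
        constructor <;> linarith [h2.1, h2.2, h5.1, h5.2, h6.1, h6.2])
      (fun v hv => by
        rw [← horth i hi v hv]
        congr 1
        ext t
        simp only [he'', Polynomial.eval_sub]
        ring) s hs
      (hroot.imp_left fun h =>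
        (Polynomial.natDegree_sub_le_of_le h (hPdeg i hi)).trans_eq (max_self m))
    have h2 := hε _ (affMap_mem_Icc hlt.le hs)
    rw [Polynomial.eval_sub] at h1
    simp only [he'']
    rw [abs_le] at h1 h2 ⊢
    constructor <;> linarith [h1.1, h1.2, h2.1, h2.2]
  have htaylor : ∀ n, n + 1 ≤ m + 2 → ∀ i ∈ Finset.Icc 1 N,
      ∃ T : Polynomial ℝ, T.natDegree ≤ n ∧ ∀ t ∈ Set.Icc (x (i - 1)) (x i),
        |iteratedDeriv 2 u t - T.eval t| ≤ M * h ^ (n + 1) := by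
    intro n hn i hi
    obtain ⟨h1, h2, h3⟩ := hx.element hi
    obtain ⟨T, hT, hTe⟩ := exists_natDegree_le_abs_sub_eval_le (f := iteratedDeriv 2 u) (n := n)
      (M := M) h2 (hu2.of_le (by exact_mod_cast hn)) (fun t ht => by
        rw [iteratedDeriv_iteratedDeriv_two]
        exact hM' _ (by lia) t ⟨h1.trans ht.1, ht.2.trans h3⟩)
    refine ⟨T, hT, fun t ht => (hTe t ht).trans ?_⟩
    have := hsize.1 i hi
    have h4 : 0 ≤ x i - x (i - 1) := by linarith
    gcongr
  have himp : ∀ B : ℝ, (∀ i ∈ Finset.Icc 1 N, ∀ t ∈ Set.Icc (x (i - 1)) (x i),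
        |e i t| ≤ B ∧ |e' i t| ≤ B) →
      ∀ i ∈ Finset.Icc 1 N, ∀ t ∈ Set.Icc (x (i - 1)) (x i),
        |e i t| ≤ C₂ * D * (M * h ^ (m + 2)) + B / 2 ∧
          |e' i t| ≤ C₂ * D * (M * h ^ (m + 2)) + B / 2 := by
    intro B hB
    have hB0 : 0 ≤ B := (abs_nonneg _).trans
      (hB 1 h1N _ (Set.left_mem_Icc.2 (hx.element h1N).2.1.le)).1
    have hs := hstab a b hab N x h hx hsize.1 e e' e'' hde hde' hce''
      (fun i hi => by simp only [he, hP.1.2.1 i hi])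
      (fun i hi => by simp only [he', hP.1.2.2.1 i hi])
      (by simp only [he]; rw [ hP.1.2.2.2.1, hx.2.1, hua, sub_zero])
      (by simp only [he]; rw [hP.1.2.2.2.2, hx.2.2.1, hub, sub_zero])
      (D * (M * h ^ (m + 1) + κ * B))
      (fun i hi => by simpa using horth i hi 1 (by simp))
      (fun i hi t ht => by
        obtain ⟨T, hT, hTe⟩ := htaylor m (by lia) i hi
        obtain ⟨s, hs, rfl⟩ := exists_affMap_eq (hx.element hi).2.1 ht
        have h1 := hest i hi B _ (hB i hi) T (hT.trans (by lia)) hTe s hs (Or.inl hT)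
        obtain ⟨h3, h4⟩ := hB i hi _ ht
        have h5 : |(μ + ν) * e' i (affMap (x (i - 1)) (x i) s)| ≤ |μ + ν| * B := by
          rw [abs_mul]; gcongr
        have h6 : |μ * ν * e i (affMap (x (i - 1)) (x i) s)| ≤ |μ * ν| * B := by
          rw [abs_mul]; gcongr
        have h7 : D * (M * h ^ (m + 1) + κ * B) = C₁ * (M * h ^ (m + 1) + κ * B)
            + M * h ^ (m + 1) + (|μ + ν| * B + |μ * ν| * B) := by
          simp only [hD, hκ]
          ring
        rw [h7]
        rw [abs_le] at h1 h5 h6 ⊢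
        constructor <;> linarith [h1.1, h1.2, h5.1, h5.2, h6.1, h6.2])
    have hle : C₂ * (h * (D * (M * h ^ (m + 1) + κ * B)))
        ≤ C₂ * D * (M * h ^ (m + 2)) + B / 2 := by
      have h1 : h * (C₂ * D * (κ + 1)) ≤ 1 / 2 := by
        rw [le_div_iff₀ (by positivity)] at hh
        linarith
      have h2 : h * (C₂ * D * κ) ≤ 1 / 2 := by
        refine le_trans ?_ h1
        gcongr
        linarith
      have h3 := mul_le_mul_of_nonneg_right h2 hB0
      have h4 : C₂ * (h * (D * (M * h ^ (m + 1) + κ * B)))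
          = C₂ * D * (M * h ^ (m + 2)) + h * (C₂ * D * κ) * B := by ring
      linarith
    exact fun i hi t ht => (hs i hi t ht).imp (le_trans · hle) (le_trans · hle)
  have hbound : ∀ i ∈ Finset.Icc 1 N, ∀ t ∈ Set.Icc (x (i - 1)) (x i),
      |e i t| ≤ 2 * (C₂ * D * (M * h ^ (m + 2))) ∧
        |e' i t| ≤ 2 * (C₂ * D * (M * h ^ (m + 2))) := by
    have hcomp : ∀ i, ∃ B, ∀ t ∈ Set.Icc (x (i - 1)) (x i), max |e i t| |e' i t| ≤ B :=
      fun i => by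
        obtain ⟨B, hB⟩ := IsCompact.bddAbove_image (K := Set.Icc (x (i - 1)) (x i))
          (f := fun t => max |e i t| |e' i t|) isCompact_Icc (by fun_prop)
        exact ⟨B, fun t ht => hB (Set.mem_image_of_mem _ ht)⟩
    choose Bf hBf using hcomp
    have key := le_two_mul_of_forall_improve
      (ι := {p : ℕ × ℝ // p.1 ∈ Finset.Icc 1 N ∧ p.2 ∈ Set.Icc (x (p.1 - 1)) (x p.1)})
      (f := fun p => max |e p.1.1 p.1.2| |e' p.1.1 p.1.2|) (Q := C₂ * D * (M * h ^ (m + 2)))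
      (B₀ := ∑ i ∈ Finset.Icc 1 N, |Bf i|)
      (fun p => (hBf _ _ p.2.2).trans ((le_abs_self _).trans
        (Finset.single_le_sum (f := fun i => |Bf i|) (fun _ _ => abs_nonneg _) p.2.1)))
      (fun B hB p => max_le_iff.2 (himp B
        (fun i hi t ht => max_le_iff.1 (hB ⟨(i, t), hi, ht⟩)) _ p.2.1 _ p.2.2))
    exact fun i hi t ht => max_le_iff.1 (key ⟨(i, t), hi, ht⟩)
  obtain ⟨T, hT, hTe⟩ := htaylor (m + 1) le_rfl i hi
  refine (hest i hi _ _ (hbound i hi) T hT hTe s (Set.Ioo_subset_Icc_self hs)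
    (Or.inr hroot)).trans_eq ?_
  ring
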